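/- Let ℓ ≥ 1 be an integer, L ≥ 1024 a real, X a finite set with |X| = n, p ∈ (0,1], and let w be a positive integer with Lpn ≤ w ≤ n. Let H be an ℓ-bounded hypergraph on X, and for each w-subset W of X fix a function T(·,W) assigning to each S ∈ H a minimum (S,W)-fragment; set t(S,W) = |T(S,W)|, G(W) = {S ∈ H : t(S,W) ≥ 0.9ℓ}, and U(W) = {T(S,W) : S ∈ G(W)}. Then Σ_{W} Σ_{U ∈ U(W)} p^{|U|} ≤ C(n, w) · L^{−0.6ℓ}, where the outer sum is over all w-subsets W of X. -/

import Mathlib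

open Finset

/-- `T` is an `(S,W)`-fragment (with respect to `H`): `T = S' ∖ W` for some
`S' ∈ H` with `S' ⊆ S ∪ W`. -/
def IsFragment {α : Type*} [DecidableEq α] (H : Finset (Finset α))
    (S W T : Finset α) : Prop :=
  ∃ S' ∈ H, S' ⊆ S ∪ W ∧ T = S' \ W

/-- `T` is a minimum `(S,W)`-fragment: an `(S,W)`-fragment of minimum size. -/
def IsMinFragment {α : Type*} [DecidableEq α] (H : Finset (Finset α))
    (S W T : Finset α) : Prop :=
  IsFragment H S W T ∧ ∀ T', IsFragment H S W T' → T.card ≤ T'.card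

theorem IsMinFragment.disjoint {α : Type*} [DecidableEq α] {H : Finset (Finset α)}
    {S W T : Finset α} (h : IsMinFragment H S W T) : Disjoint W T := by
  obtain ⟨⟨S', -, -, rfl⟩, -⟩ := h
  exact disjoint_sdiff

theorem IsMinFragment.exists_subset_union {α : Type*} [DecidableEq α] {H : Finset (Finset α)}
    {S W T : Finset α} (h : IsMinFragment H S W T) : ∃ R ∈ H, R ⊆ W ∪ T := by
  obtain ⟨⟨S', hS', -, rfl⟩, -⟩ := h
  exact ⟨S', hS', by grind⟩

theorem IsMinFragment.card_le {α : Type*} [DecidableEq α] {H : Finset (Finset α)}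
    {S W T : Finset α} {ℓ : ℕ} (hbd : ∀ S ∈ H, S.card ≤ ℓ) (h : IsMinFragment H S W T) :
    T.card ≤ ℓ := by
  obtain ⟨⟨S', hS', -, rfl⟩, -⟩ := h
  exact (card_le_card sdiff_subset).trans (hbd S' hS')

/-- A minimum fragment `T` is contained in every edge inside `W ∪ T`. -/
theorem IsMinFragment.subset_of_subset_union {α : Type*} [DecidableEq α]
    {H : Finset (Finset α)} {S W T R : Finset α} (h : IsMinFragment H S W T) (hR : R ∈ H)
    (hRT : R ⊆ W ∪ T) : T ⊆ R := by
  obtain ⟨⟨S', -, hsub, rfl⟩, hmin⟩ := h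
  have hle : (S' \ W).card ≤ (R \ W).card := hmin _ ⟨R, hR, by grind, rfl⟩
  have heq : R \ W = S' \ W := eq_of_subset_of_card_le (by grind) hle
  exact heq ▸ sdiff_subset

/-- The number of pairs `(W, U)` with `U` a minimum `W`-fragment of size `t`. -/
theorem card_sigma_minFragment_le {α : Type*} [Fintype α] [DecidableEq α] {ℓ w : ℕ}
    {H : Finset (Finset α)} (hbd : ∀ S ∈ H, S.card ≤ ℓ)
    (𝒰 : Finset α → Finset (Finset α))
    (h𝒰 : ∀ W ∈ (univ : Finset α).powersetCard w, ∀ U ∈ 𝒰 W, ∃ S, IsMinFragment H S W U)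
    (t : ℕ) :
    (((univ : Finset α).powersetCard w).sigma
        fun W => (𝒰 W).filter fun U => U.card = t).card
      ≤ (Fintype.card α).choose (w + t) * ℓ.choose t := by
  have hedge : ∀ Z : Finset α, ∃ R : Finset α, R.card ≤ ℓ ∧
      ((∃ R ∈ H, R ⊆ Z) → R ∈ H ∧ R ⊆ Z) := by
    intro Z
    by_cases h : ∃ R ∈ H, R ⊆ Z
    · obtain ⟨R, hR, hRZ⟩ := h
      exact ⟨R, hbd R hR, fun _ => ⟨hR, hRZ⟩⟩
    · exact ⟨∅, by simp, fun h' => absurd h' h⟩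
  choose edge hcard hedge using hedge
  calc _ ≤ (((univ : Finset α).powersetCard (w + t)).sigma
        fun Z => (edge Z).powersetCard t).card := by
        refine card_le_card_of_injOn (fun x => ⟨x.1 ∪ x.2, x.2⟩) ?_ ?_
        · rintro ⟨W, U⟩ hx
          simp only [coe_sigma, Set.mem_sigma_iff, mem_coe, mem_filter] at hx ⊢
          obtain ⟨hW, hU, rfl⟩ := hx
          obtain ⟨S, hS⟩ := h𝒰 W hW U hU
          obtain ⟨hR, hRZ⟩ := hedge _ hS.exists_subset_union
          simp only [mem_powersetCard, subset_univ, true_and, and_true] at hW ⊢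
          exact ⟨by rw [card_union_of_disjoint hS.disjoint, hW],
            hS.subset_of_subset_union hR hRZ⟩
        · rintro ⟨W, U⟩ hx ⟨W', U'⟩ hx' heq
          simp only [coe_sigma, Set.mem_sigma_iff, mem_coe, mem_filter] at hx hx'
          simp only [Sigma.mk.injEq, heq_eq_eq] at heq
          obtain ⟨hunion, rfl⟩ := heq
          obtain ⟨S, hS⟩ := h𝒰 W hx.1 U hx.2.1
          obtain ⟨S', hS'⟩ := h𝒰 W' hx'.1 U hx'.2.1
          rw [← union_sdiff_cancel_right hS.disjoint, hunion,
            union_sdiff_cancel_right hS'.disjoint]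
    _ ≤ ∑ _Z ∈ (univ : Finset α).powersetCard (w + t), ℓ.choose t := by
        rw [card_sigma]
        refine sum_le_sum fun Z _ => ?_
        rw [card_powersetCard]
        exact Nat.choose_le_choose t (hcard Z)
    _ = _ := by simp [card_powersetCard]

theorem Nat.choose_add_mul_pow_le (n w t : ℕ) :
    n.choose (w + t) * w ^ t ≤ n.choose w * n ^ t := by
  induction t with
  | zero => simp
  | succ t ih =>
    calc n.choose (w + (t + 1)) * w ^ (t + 1)
        ≤ n.choose (w + t + 1) * (w + t + 1) * w ^ t := by
          rw [pow_succ, ← add_assoc, mul_comm (w ^ t) w, ← mul_assoc]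
          gcongr
          omega
      _ = n.choose (w + t) * (n - (w + t)) * w ^ t := by rw [Nat.choose_succ_right_eq]
      _ ≤ n.choose (w + t) * n * w ^ t := by gcongr; omega
      _ = n.choose (w + t) * w ^ t * n := by ring
      _ ≤ n.choose w * n ^ t * n := by gcongr
      _ = n.choose w * n ^ (t + 1) := by ring

theorem choose_add_mul_pow_le_mul_inv_pow {n w : ℕ} {L p : ℝ} (hL : 0 < L) (hp : 0 ≤ p)
    (hn : 0 < n) (hw : L * p * n ≤ w) (t : ℕ) :
    (n.choose (w + t) : ℝ) * p ^ t ≤ n.choose w * (L ^ t)⁻¹ := by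
  have hn' : (0 : ℝ) < n := by exact_mod_cast hn
  rw [← div_eq_mul_inv, le_div_iff₀ (by positivity)]
  refine le_of_mul_le_mul_right ?_ (pow_pos hn' t)
  calc (n.choose (w + t) : ℝ) * p ^ t * L ^ t * (n : ℝ) ^ t
      = n.choose (w + t) * (L * p * n) ^ t := by ring
    _ ≤ n.choose (w + t) * (w : ℝ) ^ t := by gcongr
    _ ≤ n.choose w * (n : ℝ) ^ t := by exact_mod_cast Nat.choose_add_mul_pow_le n w t

theorem two_pow_mul_rpow_le {L : ℝ} (hL : 1024 ≤ L) (ℓ : ℕ) :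
    (2 : ℝ) ^ ℓ * L ^ (-(0.9 : ℝ) * ℓ) ≤ L ^ (-(0.6 : ℝ) * ℓ) := by
  have hL0 : 0 < L := by linarith
  have h2 : (2 : ℝ) ≤ L ^ (0.1 : ℝ) :=
    calc (2 : ℝ) = (1024 : ℝ) ^ (0.1 : ℝ) := by
          rw [show (1024 : ℝ) = 2 ^ (10 : ℝ) by norm_num, ← Real.rpow_mul (by norm_num)]
          norm_num
      _ ≤ L ^ (0.1 : ℝ) := by gcongr
  calc (2 : ℝ) ^ ℓ * L ^ (-(0.9 : ℝ) * ℓ)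
      ≤ (L ^ (0.1 : ℝ)) ^ ℓ * L ^ (-(0.9 : ℝ) * ℓ) := by gcongr
    _ = L ^ ((0.1 : ℝ) * ℓ + -(0.9 : ℝ) * ℓ) := by
        rw [← Real.rpow_mul_natCast hL0.le, ← Real.rpow_add hL0]
    _ ≤ L ^ (-(0.6 : ℝ) * ℓ) := by
        refine Real.rpow_le_rpow_of_exponent_le (by linarith) ?_
        have : (0 : ℝ) ≤ ℓ := by positivity
        linarith

/-- The total cost of the covers `U(W)` over all `w`-subsets `W` of `X` is at most
`C(n, w) L^{-0.6 ℓ}`. -/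
theorem sum_cover_cost_le {α : Type*} [Fintype α] [DecidableEq α]
    (ℓ : ℕ) (hℓ : 1 ≤ ℓ) (L : ℝ) (hL : 1024 ≤ L)
    (p : ℝ) (hp0 : 0 < p) (hp1 : p ≤ 1)
    (w : ℕ) (hw0 : 0 < w) (hwl : L * p * (Fintype.card α : ℝ) ≤ (w : ℝ))
    (hwn : w ≤ Fintype.card α)
    (H : Finset (Finset α)) (hbd : ∀ S ∈ H, S.card ≤ ℓ)
    (TW : Finset α → Finset α → Finset α)
    (hTW : ∀ W ∈ (Finset.univ : Finset α).powersetCard w,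
      ∀ S ∈ H, IsMinFragment H S W (TW W S)) :
    ∑ W ∈ (Finset.univ : Finset α).powersetCard w,
        ∑ U ∈ (H.filter fun S => (0.9 : ℝ) * (ℓ : ℝ) ≤ ((TW W S).card : ℝ)).image (TW W),
          p ^ U.card
      ≤ ((Fintype.card α).choose w : ℝ) * L ^ (-(0.6 : ℝ) * (ℓ : ℝ)) := by
  have hL0 : 0 < L := by linarith
  set 𝒰 : Finset α → Finset (Finset α) := fun W =>
    (H.filter fun S => (0.9 : ℝ) * (ℓ : ℝ) ≤ ((TW W S).card : ℝ)).image (TW W) with h𝒰_def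
  have h𝒰 : ∀ W ∈ (univ : Finset α).powersetCard w, ∀ U ∈ 𝒰 W,
      (∃ S, IsMinFragment H S W U) ∧ (0.9 : ℝ) * ℓ ≤ U.card := by
    intro W hW U hU
    obtain ⟨S, hS, rfl⟩ := mem_image.1 hU
    obtain ⟨hSH, hcard⟩ := mem_filter.1 hS
    exact ⟨⟨S, hTW W hW S hSH⟩, hcard⟩
  set P := ((univ : Finset α).powersetCard w).sigma 𝒰 with hP
  have hlevel : ∀ t ∈ range (ℓ + 1), ∑ x ∈ P with x.2.card = t, p ^ x.2.card
      ≤ (Fintype.card α).choose w * L ^ (-(0.9 : ℝ) * ℓ) * ℓ.choose t := by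
    intro t _
    rcases (P.filter fun x => x.2.card = t).eq_empty_or_nonempty with hempty | ⟨⟨W, U⟩, hx⟩
    · rw [hempty, sum_empty]
      positivity
    obtain ⟨hx, ht⟩ := mem_filter.1 hx
    have ht9 : (0.9 : ℝ) * ℓ ≤ t :=
      ht ▸ (h𝒰 W (mem_sigma.1 hx).1 U (mem_sigma.1 hx).2).2
    have hcount := card_sigma_minFragment_le hbd 𝒰 (fun W hW U hU => (h𝒰 W hW U hU).1) t
    have hfilter : (P.filter fun x => x.2.card = t) =
        ((univ : Finset α).powersetCard w).sigma
          fun W => (𝒰 W).filter fun U => U.card = t := by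
      ext x
      simp only [hP, mem_filter, mem_sigma, and_assoc]
    have hpow : (L ^ t)⁻¹ ≤ L ^ (-(0.9 : ℝ) * ℓ) := by
      rw [← Real.rpow_natCast, ← Real.rpow_neg hL0.le]
      exact Real.rpow_le_rpow_of_exponent_le (by linarith) (by linarith)
    calc ∑ x ∈ P with x.2.card = t, p ^ x.2.card
        = (P.filter fun x => x.2.card = t).card * p ^ t := by
          rw [← nsmul_eq_mul, ← sum_const]
          exact sum_congr rfl fun x hx => by rw [(mem_filter.1 hx).2]
      _ ≤ ((Fintype.card α).choose (w + t) * ℓ.choose t : ℝ) * p ^ t := by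
          rw [hfilter]
          gcongr
          exact_mod_cast hcount
      _ = (Fintype.card α).choose (w + t) * p ^ t * ℓ.choose t := by ring
      _ ≤ (Fintype.card α).choose w * (L ^ t)⁻¹ * ℓ.choose t := by
          gcongr ?_ * _
          exact choose_add_mul_pow_le_mul_inv_pow hL0 hp0.le (hw0.trans_le hwn) hwl t
      _ ≤ _ := by gcongr
  calc ∑ W ∈ (univ : Finset α).powersetCard w, ∑ U ∈ 𝒰 W, p ^ U.card
      = ∑ x ∈ P, p ^ x.2.card := by rw [hP, sum_sigma]
    _ = ∑ t ∈ range (ℓ + 1), ∑ x ∈ P with x.2.card = t, p ^ x.2.card := by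
        refine (sum_fiberwise_of_maps_to (fun x hx => ?_) _).symm
        obtain ⟨hW, hU⟩ := mem_sigma.1 hx
        obtain ⟨⟨S, hS⟩, -⟩ := h𝒰 _ hW _ hU
        exact mem_range.2 (Nat.lt_succ_of_le (hS.card_le hbd))
    _ ≤ ∑ t ∈ range (ℓ + 1),
          (Fintype.card α).choose w * L ^ (-(0.9 : ℝ) * ℓ) * ℓ.choose t := sum_le_sum hlevel
    _ = (Fintype.card α).choose w * ((2 : ℝ) ^ ℓ * L ^ (-(0.9 : ℝ) * ℓ)) := by
        rw [← mul_sum, ← Nat.cast_sum, Nat.sum_range_choose]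
        push_cast
        ring
    _ ≤ _ := by
        gcongr
        exact two_pow_mul_rpow_le hL ℓ
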